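/- arXiv:1702.07632 — 2 statements merged into one kernel-verified Lean document; each statement's English description precedes it below -/
import Mathlib

section
/- (Step 3 of the real case.) Let q ∈ ℕ, let N, N' : Fin q → ℤ with N i ≥ 1 and N' i ≥ 1 for all i, and let u, u' : Fin q → ℂ. Assume that for every integer M ≥ 0 and every s ∈ ℂ, ∏_{i : Fin q} 4·(2π)^{−2(s + u i) + min(N i, M)}·Γ(s + u i)·Γ(s + u i − min(N i, M)) = ∏_{i : Fin q} 4·(2π)^{−2(s + u' i) + min(N' i, M)}·Γ(s + u' i)·Γ(s + u' i − min(N' i, M)). Then the multiset of pairs {(N i, u i) : i ∈ Fin q} equals {(N' i, u' i) : i ∈ Fin q} in Multiset (ℤ × ℂ). -/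
open Complex

/-- The Artin L-factor attached to parameters `(n, a)` and `(m, s)`. -/
noncomputable def artinFactor (n m : ℤ) (a s : ℂ) : ℂ :=
  4 * (2 * (Real.pi : ℂ)) ^ (-(2 * (s + a)) + ((min n m : ℤ) : ℂ)) *
    Complex.Gamma (s + a) * Complex.Gamma (s + a - ((min n m : ℤ) : ℂ))

lemma two_pi_complex_ne_zero : (2 * (Real.pi : ℂ)) ≠ 0 :=
  mul_ne_zero two_ne_zero (ofReal_ne_zero.2 Real.pi_ne_zero)

lemma artinFactor_ne_zero {n m : ℤ} {a s : ℂ} (h₀ : 0 < (s + a).re)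
    (hm : (m : ℝ) < (s + a).re) : artinFactor n m a s ≠ 0 := by
  have hmin : ((min n m : ℤ) : ℝ) ≤ m := by exact_mod_cast min_le_right n m
  refine mul_ne_zero (mul_ne_zero (mul_ne_zero (by norm_num) ?_) ?_) ?_
  · simp [cpow_eq_zero_iff]
  · exact Gamma_ne_zero_of_re_pos h₀
  · refine Gamma_ne_zero_of_re_pos ?_
    rw [sub_re, intCast_re]
    linarith

/-- Raising `m` by one changes the L-factor by a linear factor if `m < n`, and not at all
otherwise. -/
lemma artinFactor_eq_mul_artinFactor_succ {n m : ℤ} {a s : ℂ}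
    (hm : s + a - (m + 1 : ℤ) ≠ 0) :
    artinFactor n m a s =
      (if m < n then (2 * (Real.pi : ℂ))⁻¹ * (s - ((m + 1 : ℤ) - a)) else 1) *
        artinFactor n (m + 1) a s := by
  unfold artinFactor
  split_ifs with hn
  · rw [min_eq_right hn.le, min_eq_right (Int.add_one_le_iff.2 hn)]
    have hΓ := Gamma_add_one _ hm
    have e₁ : s + a - ((m + 1 : ℤ) : ℂ) + 1 = s + a - m := by push_cast; ring
    have e₂ : -(2 * (s + a)) + ((m + 1 : ℤ) : ℂ) = -(2 * (s + a)) + m + 1 := by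
      push_cast; ring
    rw [e₁] at hΓ
    rw [hΓ, e₂, cpow_add (-(2 * (s + a)) + m) 1 two_pi_complex_ne_zero, cpow_one]
    have := two_pi_complex_ne_zero
    field_simp
    ring
  · rw [min_eq_left (not_lt.1 hn), min_eq_left (by omega), one_mul]

open Polynomial in
/-- The polynomial ratio of the L-factors at consecutive values of `m`. -/
noncomputable def ratioPoly {ι : Type*} [Fintype ι] (N : ι → ℤ) (u : ι → ℂ) (m : ℤ) : ℂ[X] :=
  ∏ i with m < N i, C (2 * (Real.pi : ℂ))⁻¹ * (X - C (((m + 1 : ℤ) : ℂ) - u i))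

open Polynomial in
lemma count_roots_ratioPoly {ι : Type*} [Fintype ι] (N : ι → ℤ) (u : ι → ℂ) (m : ℤ) (z : ℂ) :
    (ratioPoly N u m).roots.count (((m + 1 : ℤ) : ℂ) - z) =
      Finset.card {i | m < N i ∧ u i = z} := by
  classical
  have hroots : (ratioPoly N u m).roots =
      (Finset.univ.filter (fun i => m < N i)).val.map (fun i => ((m + 1 : ℤ) : ℂ) - u i) := by
    rw [ratioPoly, Finset.prod_mul_distrib, Finset.prod_const, ← C_pow,
      roots_C_mul _ (pow_ne_zero _ (inv_ne_zero two_pi_complex_ne_zero))]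
    rw [← roots_multiset_prod_X_sub_C (Multiset.map _ _), Multiset.map_map]
    rfl
  rw [hroots, Multiset.count_map, ← Finset.filter_val, Finset.card_val, Finset.filter_filter]
  congr 1
  ext i
  simp [eq_comm]

lemma prod_artinFactor_eq {ι : Type*} [Fintype ι] (N : ι → ℤ) (u : ι → ℂ) (m : ℤ) (s : ℂ)
    (hm : ∀ i, s + u i - (m + 1 : ℤ) ≠ 0) :
    ∏ i, artinFactor (N i) m (u i) s =
      (ratioPoly N u m).eval s * ∏ i, artinFactor (N i) (m + 1) (u i) s := by
  rw [ratioPoly, Polynomial.eval_prod, Finset.prod_filter, ← Finset.prod_mul_distrib]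
  refine Finset.prod_congr rfl fun i _ => ?_
  rw [artinFactor_eq_mul_artinFactor_succ (hm i)]
  simp

lemma ratioPoly_eq_of_prod_artinFactor_eq {ι : Type*} [Fintype ι] {N N' : ι → ℤ} {u u' : ι → ℂ}
    {m : ℤ} (hm : 0 ≤ m)
    (h : ∀ M : ℤ, 0 ≤ M → ∀ s : ℂ,
      ∏ i, artinFactor (N i) M (u i) s = ∏ i, artinFactor (N' i) M (u' i) s) :
    ratioPoly N u m = ratioPoly N' u' m := by
  have hlarge : ∀ v : ι → ℂ, ∀ᶠ k : ℕ in Filter.atTop, ∀ i,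
      ((m + 1 : ℤ) : ℝ) < ((k : ℂ) + v i).re := by
    intro v
    refine Filter.eventually_all.2 fun i => ?_
    filter_upwards [tendsto_natCast_atTop_atTop.eventually_gt_atTop
      (((m + 1 : ℤ) : ℝ) - (v i).re)] with k hk
    rw [add_re, natCast_re]
    linarith
  obtain ⟨K, hK⟩ := Filter.eventually_atTop.1 ((hlarge u).and (hlarge u'))
  have hne : ∀ {w : ℂ}, ((m + 1 : ℤ) : ℝ) < w.re → w - (m + 1 : ℤ) ≠ 0 := by
    intro w hw h₀
    rw [sub_eq_zero.1 h₀, intCast_re] at hw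
    exact lt_irrefl _ hw
  have hpos : (0 : ℝ) ≤ ((m + 1 : ℤ) : ℝ) := by exact_mod_cast (by omega : 0 ≤ m + 1)
  refine Polynomial.eq_of_infinite_eval_eq _ _
    (((Set.Ici_infinite K).image (Nat.cast_injective (R := ℂ)).injOn).mono ?_)
  rintro _ ⟨k, hk, rfl⟩
  obtain ⟨hu, hu'⟩ := hK k hk
  have hprod : ∏ i, artinFactor (N i) (m + 1) (u i) k ≠ 0 :=
    Finset.prod_ne_zero_iff.2 fun i _ => artinFactor_ne_zero (hpos.trans_lt (hu i)) (hu i)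
  have hmul := h m hm k
  rw [prod_artinFactor_eq N u m k fun i => hne (hu i),
    prod_artinFactor_eq N' u' m k fun i => hne (hu' i), ← h (m + 1) (by omega) k] at hmul
  exact mul_right_cancel₀ hprod hmul

lemma card_pair_add_card_lt {ι : Type*} [Fintype ι] (N : ι → ℤ) (u : ι → ℂ) (n : ℤ) (z : ℂ) :
    Finset.card {i | (n, z) = (N i, u i)} + Finset.card {i | n < N i ∧ u i = z} =
      Finset.card {i | n - 1 < N i ∧ u i = z} := by
  classical
  rw [← Finset.card_union_of_disjoint]
  · congr 1
    ext i
    simp only [Finset.mem_union, Finset.mem_filter_univ, Prod.mk.injEq]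
    grind
  · rw [Finset.disjoint_filter]
    rintro i - hi ⟨hlt, -⟩
    exact hlt.ne (Prod.mk.inj hi).1

theorem real_case_step3 (q : ℕ)
    (N N' : Fin q → ℤ) (hN : ∀ i, 1 ≤ N i) (hN' : ∀ i, 1 ≤ N' i)
    (u u' : Fin q → ℂ)
    (h : ∀ M : ℤ, 0 ≤ M → ∀ s : ℂ,
      ∏ i : Fin q, 4 * (2 * (Real.pi : ℂ)) ^ (-(2 * (s + u i)) + ((min (N i) M : ℤ) : ℂ)) *
          Complex.Gamma (s + u i) * Complex.Gamma (s + u i - ((min (N i) M : ℤ) : ℂ))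
      = ∏ i : Fin q, 4 * (2 * (Real.pi : ℂ)) ^ (-(2 * (s + u' i)) + ((min (N' i) M : ℤ) : ℂ)) *
          Complex.Gamma (s + u' i) * Complex.Gamma (s + u' i - ((min (N' i) M : ℤ) : ℂ))) :
    Finset.univ.val.map (fun i => (N i, u i)) = Finset.univ.val.map (fun i => (N' i, u' i)) := by
  classical
  have hcard : ∀ m : ℤ, 0 ≤ m → ∀ z : ℂ,
      Finset.card {i | m < N i ∧ u i = z} = Finset.card {i | m < N' i ∧ u' i = z} := by
    intro m hm z
    rw [← count_roots_ratioPoly, ← count_roots_ratioPoly,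
      ratioPoly_eq_of_prod_artinFactor_eq hm h]
  ext ⟨n, z⟩
  rw [Multiset.count_map, Multiset.count_map, ← Finset.filter_val, ← Finset.filter_val,
    Finset.card_val, Finset.card_val]
  rcases le_or_gt n 0 with hn | hn
  · rw [Finset.filter_false_of_mem, Finset.filter_false_of_mem]
    · intro i _ hi
      have := (Prod.mk.inj hi).1
      have := hN' i
      omega
    · intro i _ hi
      have := (Prod.mk.inj hi).1
      have := hN i
      omega
  · have e := card_pair_add_card_lt N u n z
    have e' := card_pair_add_card_lt N' u' n z
    rw [hcard n hn.le z, hcard (n - 1) (by omega) z, ← e'] at e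
    convert Nat.add_right_cancel e
end

section
/- (GL_3(ℝ) proposition, case of two parameters each with a 2-dimensional constituent.) Let N, N' ∈ ℤ with N ≥ 1 and N' ≥ 1, let ε, ε' ∈ ℕ with ε ≤ 1 and ε' ≤ 1, and let t, t', u, u' ∈ ℂ. Write γ(ε,δ) = 2 if ε = δ = 1 and γ(ε,δ) = 0 otherwise. Assume: (central character equality) 2t − N + u − ε = 2t' − N' + u' − ε' and N + ε ≡ N' + ε' (mod 2); and (L-factor equality) for every δ ∈ {0,1} and every s ∈ ℂ, 2·(2π)^{−(s + t − δ)}·Γ(s + t − δ) · π^{−(s + u − γ(ε,δ))/2}·Γ((s + u − γ(ε,δ))/2) = 2·(2π)^{−(s + t' − δ)}·Γ(s + t' − δ) · π^{−(s + u' − γ(ε',δ))/2}·Γ((s + u' − γ(ε',δ))/2). Then N = N', t = t', u = u' and ε = ε'. -/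
open Complex

/-- `γ(ε, δ) = 2` if `ε = δ = 1` and `0` otherwise. -/
def gam (e d : ℕ) : ℕ := if e = 1 ∧ d = 1 then 2 else 0

/-- The product of the archimedean Euler factors `2 (2π)^{-(s+a)} Γ(s+a)` and
`π^{-(s+b)/2} Γ((s+b)/2)`. -/
noncomputable def archFactor (a b s : ℂ) : ℂ :=
  2 * (2 * (Real.pi : ℂ)) ^ (-(s + a)) * Complex.Gamma (s + a) *
    ((Real.pi : ℂ) ^ (-((s + b) / 2)) * Complex.Gamma ((s + b) / 2))

lemma archFactor_ne_zero {a b s : ℂ} (ha : 0 < (s + a).re) (hb : 0 < (s + b).re) :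
    archFactor a b s ≠ 0 := by
  have hπ : (Real.pi : ℂ) ≠ 0 := ofReal_ne_zero.mpr Real.pi_ne_zero
  have hb' : 0 < ((s + b) / 2).re := by
    rw [div_ofNat_re]
    positivity
  have h2π : (2 * Real.pi : ℂ) ≠ 0 := mul_ne_zero two_ne_zero hπ
  exact mul_ne_zero
    (mul_ne_zero (mul_ne_zero two_ne_zero (cpow_ne_zero_iff_of_exponent_ne_zero
      (neg_ne_zero.mpr fun h ↦ by simp [h] at ha) |>.mpr h2π)) (Gamma_ne_zero_of_re_pos ha))
    (mul_ne_zero (cpow_ne_zero_iff_of_exponent_ne_zero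
      (neg_ne_zero.mpr fun h ↦ by simp [h] at hb') |>.mpr hπ) (Gamma_ne_zero_of_re_pos hb'))

lemma archFactor_add_two {a b s : ℂ} (ha : 0 < (s + a).re) (hb : 0 < (s + b).re) :
    archFactor a b (s + 2) =
      (8 * (Real.pi : ℂ) ^ 3)⁻¹ * ((s + a) * (s + a + 1) * (s + b)) * archFactor a b s := by
  have hπ : (Real.pi : ℂ) ≠ 0 := ofReal_ne_zero.mpr Real.pi_ne_zero
  have h2π : (2 * Real.pi : ℂ) ≠ 0 := mul_ne_zero two_ne_zero hπ
  have ha0 : s + a ≠ 0 := fun h ↦ by simp [h] at ha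
  have ha1 : s + a + 1 ≠ 0 := fun h ↦ by
    have := congrArg re h
    rw [add_re, one_re, zero_re] at this
    linarith
  have hb0 : (s + b) / 2 ≠ 0 := fun h ↦ by
    have : s + b = 0 := by linear_combination 2 * h
    simp [this] at hb
  have hΓa : Gamma (s + 2 + a) = (s + a + 1) * ((s + a) * Gamma (s + a)) := by
    rw [← Gamma_add_one _ ha0, ← Gamma_add_one _ ha1]
    ring_nf
  have hΓb : Gamma ((s + 2 + b) / 2) = (s + b) / 2 * Gamma ((s + b) / 2) := by
    rw [← Gamma_add_one _ hb0]
    ring_nf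
  have hpa : (2 * Real.pi : ℂ) ^ (-(s + 2 + a)) =
      (2 * Real.pi : ℂ) ^ (-(s + a)) / (2 * Real.pi : ℂ) ^ 2 := by
    rw [show -(s + 2 + a) = -(s + a) - (2 : ℕ) by push_cast; ring, cpow_sub _ _ h2π, cpow_natCast]
  have hpb : (Real.pi : ℂ) ^ (-((s + 2 + b) / 2)) = (Real.pi : ℂ) ^ (-((s + b) / 2)) / Real.pi := by
    rw [show -((s + 2 + b) / 2) = -((s + b) / 2) - 1 by ring, cpow_sub _ _ hπ, cpow_one]
  rw [archFactor, archFactor, hΓa, hΓb, hpa, hpb]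
  field_simp
  ring

/-- The shift `s ↦ s + 2` recovers a cubic polynomial from `archFactor a b`. -/
lemma cubic_eq_of_archFactor_eq {a b a' b' : ℂ} (h : archFactor a b = archFactor a' b') (s : ℂ) :
    (s + a) * (s + a + 1) * (s + b) = (s + a') * (s + a' + 1) * (s + b') := by
  obtain ⟨n, hn⟩ := exists_nat_gt (|a.re| + |b.re| + |a'.re| + |b'.re|)
  have key (k : ℕ) : ((n + k : ℂ) + a) * ((n + k : ℂ) + a + 1) * ((n + k : ℂ) + b) =
      ((n + k : ℂ) + a') * ((n + k : ℂ) + a' + 1) * ((n + k : ℂ) + b') := by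
    have pos (c : ℂ) (hc : |c.re| ≤ |a.re| + |b.re| + |a'.re| + |b'.re|) :
        0 < ((n + k : ℂ) + c).re := by
      simp only [add_re, natCast_re]
      have := neg_abs_le c.re
      have : (0 : ℝ) ≤ k := k.cast_nonneg
      linarith
    have h₁ := abs_nonneg a.re
    have h₂ := abs_nonneg b.re
    have h₃ := abs_nonneg a'.re
    have h₄ := abs_nonneg b'.re
    have pa := pos a (by linarith)
    have pb := pos b (by linarith)
    have hshift := congrFun h (n + k + 2)
    rw [archFactor_add_two pa pb, archFactor_add_two (pos a' (by linarith)) (pos b' (by linarith)),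
      ← h] at hshift
    have hπ : (8 * (Real.pi : ℂ) ^ 3)⁻¹ ≠ 0 := by simp
    exact mul_left_cancel₀ hπ (mul_right_cancel₀ (archFactor_ne_zero pa pb) hshift)
  have h₀ := key 0
  have h₁ := key 1
  have h₂ := key 2
  push_cast at h₀ h₁ h₂
  linear_combination (s - n - 1) * (s - n - 2) / 2 * h₀ - (s - n) * (s - n - 2) * h₁ +
    (s - n) * (s - n - 1) / 2 * h₂

lemma add_eq_of_cubic_eq {a b a' b' : ℂ}
    (h : ∀ s : ℂ, (s + a) * (s + a + 1) * (s + b) = (s + a') * (s + a' + 1) * (s + b')) :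
    2 * a + b = 2 * a' + b' := by
  linear_combination (h 1 - 2 * h 0 + h (-1)) / 2

/-- The multiset `{a, a + 1, b}` determines `(a, b)` up to the ambiguity
`{c, c + 1, c + 2} = {c + 1, c + 2, c}`. -/
lemma eq_or_eq_add_one_of_cubic_eq {a b a' b' : ℂ}
    (h : ∀ s : ℂ, (s + a) * (s + a + 1) * (s + b) = (s + a') * (s + a' + 1) * (s + b')) :
    a = a' ∨ a = a' + 1 ∨ a' = a + 1 := by
  have h₀ : (a' - a) * (a' - a + 1) * (b' - a) = 0 := by linear_combination -h (-a)
  have h₁ : (a' - a - 1) * (a' - a) * (b' - a - 1) = 0 := by linear_combination -h (-a - 1)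
  grind

lemma gam_eq_zero_or_two (e d : ℕ) : gam e d = 0 ∨ gam e d = 2 := by
  unfold gam
  split_ifs <;> simp

lemma gam_one_injOn {e e' : ℕ} (he : e ≤ 1) (he' : e' ≤ 1) (h : gam e 1 = gam e' 1) : e = e' := by
  unfold gam at h
  grind

/-- The twists by `δ = 0, 1` together exclude the ambiguity in
`eq_or_eq_add_one_of_cubic_eq`. -/
lemma ne_add_one_of_cubic_eq {a b a' b' : ℂ} {g : ℕ} (hg : g = 0 ∨ g = 2)
    (h₀ : ∀ s : ℂ, (s + a) * (s + a + 1) * (s + b) = (s + a') * (s + a' + 1) * (s + b'))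
    (h₁ : ∀ s : ℂ, (s + (a - 1)) * (s + (a - 1) + 1) * (s + (b - g)) =
      (s + (a' - 1)) * (s + (a' - 1) + 1) * (s + (b' - g))) : a ≠ a' + 1 := by
  rintro rfl
  have hb : b = a' := by linear_combination add_eq_of_cubic_eq h₀ - h₀ (-a' - 2) / 2
  subst hb
  have : (1 - g : ℂ) = 0 := by linear_combination h₁ (-b + 1) / 2
  rcases hg with rfl | rfl <;> norm_num at this

theorem GL3_real_two_dim_case (N N' : ℤ) (hN : 1 ≤ N) (hN' : 1 ≤ N')
    (ε ε' : ℕ) (hε : ε ≤ 1) (hε' : ε' ≤ 1) (t t' u u' : ℂ)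
    (hcc1 : 2 * t - (N : ℂ) + u - (ε : ℂ) = 2 * t' - (N' : ℂ) + u' - (ε' : ℂ))
    (hcc2 : N + (ε : ℤ) ≡ N' + (ε' : ℤ) [ZMOD 2])
    (hL : ∀ δ : ℕ, δ ≤ 1 → ∀ s : ℂ,
      2 * (2 * (Real.pi : ℂ)) ^ (-(s + t - (δ : ℂ))) * Complex.Gamma (s + t - (δ : ℂ)) *
        ((Real.pi : ℂ) ^ (-((s + u - (gam ε δ : ℂ)) / 2)) *
          Complex.Gamma ((s + u - (gam ε δ : ℂ)) / 2))
      = 2 * (2 * (Real.pi : ℂ)) ^ (-(s + t' - (δ : ℂ))) * Complex.Gamma (s + t' - (δ : ℂ)) *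
        ((Real.pi : ℂ) ^ (-((s + u' - (gam ε' δ : ℂ)) / 2)) *
          Complex.Gamma ((s + u' - (gam ε' δ : ℂ)) / 2))) :
    N = N' ∧ t = t' ∧ u = u' ∧ ε = ε' := by
  have h₀ := cubic_eq_of_archFactor_eq (a := t) (b := u) (a' := t') (b' := u') <| funext fun s ↦ by
    simpa [archFactor, gam] using hL 0 zero_le_one s
  have h₁ := cubic_eq_of_archFactor_eq (a := t - 1) (b := u - gam ε 1) (a' := t' - 1)
      (b' := u' - gam ε' 1) <| funext fun s ↦ by
    simpa only [archFactor, add_sub_assoc, Nat.cast_one] using hL 1 le_rfl s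
  have hsum := add_eq_of_cubic_eq h₀
  have hgam : gam ε 1 = gam ε' 1 := by
    have : (gam ε 1 : ℂ) = gam ε' 1 := by linear_combination hsum - add_eq_of_cubic_eq h₁
    exact_mod_cast this
  rw [← hgam] at h₁
  have hg := gam_eq_zero_or_two ε 1
  have ht : t = t' := by
    rcases eq_or_eq_add_one_of_cubic_eq h₀ with h | h | h
    · exact h
    · exact absurd h (ne_add_one_of_cubic_eq hg h₀ h₁)
    · exact absurd h (ne_add_one_of_cubic_eq hg (fun s ↦ (h₀ s).symm) fun s ↦ (h₁ s).symm)
  have hεε' : ε = ε' := gam_one_injOn hε hε' hgam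
  subst ht hεε'
  have hu : u = u' := by linear_combination hsum
  refine ⟨?_, rfl, hu, rfl⟩
  have : (N : ℂ) = N' := by linear_combination hu - hcc1
  exact_mod_cast this
end
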